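/- Let k be a field of positive characteristic. Then for each integer n ≥ 3 there exists an infinite family of pairwise non-isomorphic affine k-domains C of Krull dimension n such that C^{[1]} ≅ k^{[n+1]} as k-algebras but C ≇ k^{[n]} as k-algebras. -/

import Mathlib

/-!
STATEMENT 18 (Corollary `niso`).  Let `k` be a field of positive characteristic.  Then
for each `n ≥ 3` there is an infinite family of pairwise non-isomorphic affine
`k`-domains `C` of Krull dimension `n` with `C^{[1]} ≅ k^{[n+1]}` as `k`-algebras but
`C ≇ k^{[n]}` as `k`-algebras.
-/

noncomputable section

/-- A bundled affine domain over a field `k`: a finitely generated `k`-algebra which is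
an integral domain. -/
structure AffineDomain (k : Type) [Field k] where
  carrier : Type
  [commRing : CommRing carrier]
  [isDomain : IsDomain carrier]
  [algebra : Algebra k carrier]
  [finiteType : Algebra.FiniteType k carrier]

attribute [instance] AffineDomain.commRing AffineDomain.isDomain AffineDomain.algebra
  AffineDomain.finiteType

section AsanumaRings

open Polynomial

/-- Asanuma's exponential line `z ^ (p ^ 2) + t + t ^ (p ^ 2 + p)`. -/
def lineEq (p : ℕ) {R : Type*} [CommRing R] (z t : R) : R :=
  z ^ (p ^ 2) + t + t ^ (p ^ 2 + p)

theorem map_lineEq (p : ℕ) {R S F : Type*} [CommRing R] [CommRing S] [FunLike F R S]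
    [RingHomClass F R S] (φ : F) (z t : R) : φ (lineEq p z t) = lineEq p (φ z) (φ t) := by
  simp [lineEq]

/-- The polynomial ring `k[x₁, …, xₘ, z, t]`. -/
abbrev BaseRing (k : Type*) [Field k] (m : ℕ) := MvPolynomial (Fin m ⊕ Fin 2) k

namespace BaseRing

variable (k : Type*) [Field k] (m : ℕ)

/-- The product `x₁ ⋯ xₘ`. -/
def prodX : BaseRing k m := ∏ i, MvPolynomial.X (Sum.inl i)

/-- The line, as an element of the base ring. -/
def line (p : ℕ) : BaseRing k m :=
  lineEq p (MvPolynomial.X (Sum.inr 0)) (MvPolynomial.X (Sum.inr 1))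

variable {k m}

theorem prodX_ne_zero : prodX k m ≠ 0 :=
  Finset.prod_ne_zero_iff.mpr fun _ _ => MvPolynomial.X_ne_zero _

theorem prime_X (i : Fin m) : Prime (MvPolynomial.X (Sum.inl i) : BaseRing k m) :=
  MvPolynomial.X_prime

theorem X_not_dvd_line {p : ℕ} (hp : p ≠ 0) (i : Fin m) :
    ¬ (MvPolynomial.X (Sum.inl i) : BaseRing k m) ∣ line k m p := by
  intro h
  have := map_dvd (MvPolynomial.aeval
    (Sum.elim (fun _ => 0) ![1, 0] : Fin m ⊕ Fin 2 → k)) h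
  simp [line, lineEq, hp] at this

theorem isRelPrime_line {p : ℕ} (hp : p ≠ 0) (r : ℕ) :
    IsRelPrime (prodX k m ^ r) (line k m p) := by
  refine IsRelPrime.pow_left (IsRelPrime.prod_left fun i _ => ?_)
  exact (prime_X i).irreducible.isRelPrime_iff_not_dvd.mpr (X_not_dvd_line hp i)

end BaseRing

open BaseRing

/-- The defining polynomial `(x₁ ⋯ xₘ) ^ r Y - f(z, t)`. -/
def asanumaPoly (k : Type*) [Field k] (p m r : ℕ) : (BaseRing k m)[X] :=
  C (prodX k m ^ r) * X - C (line k m p)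

theorem prime_asanumaPoly (k : Type*) [Field k] {p : ℕ} (hp : p ≠ 0) (m r : ℕ) :
    Prime (asanumaPoly k p m r) := by
  have h := irreducible_C_mul_X_add_C (a := prodX k m ^ r) (b := - line k m p)
    (pow_ne_zero _ prodX_ne_zero) ((isRelPrime_line hp r).neg_right)
  rw [asanumaPoly, sub_eq_add_neg, ← C_neg]
  exact h.prime

/-- The Asanuma ring
`k[x₁, …, xₘ, z, t, y] / ((x₁ ⋯ xₘ) ^ r y - f(z, t))`. -/
def Asanuma (k : Type*) [Field k] (p m r : ℕ) := AdjoinRoot (asanumaPoly k p m r)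

namespace Asanuma

section Basic

variable {k : Type*} [Field k] {p m r : ℕ}

instance : CommRing (Asanuma k p m r) := inferInstanceAs (CommRing (AdjoinRoot _))

instance : Algebra k (Asanuma k p m r) :=
  inferInstanceAs (Algebra k (AdjoinRoot (asanumaPoly k p m r)))

instance : Algebra.FiniteType k (Asanuma k p m r) :=
  AdjoinRoot.finiteType (asanumaPoly k p m r)

theorem isDomain (hp : p ≠ 0) : IsDomain (Asanuma k p m r) :=
  AdjoinRoot.isDomain_of_prime (prime_asanumaPoly k hp m r)

variable (k p m r) in
/-- The quotient map from the polynomial ring in `y`. -/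
def mk : (BaseRing k m)[X] →ₐ[k] Asanuma k p m r where
  __ := AdjoinRoot.mk (asanumaPoly k p m r)
  commutes' _ := rfl

variable (k p m r) in
/-- The structure map from the base ring. -/
def of : BaseRing k m →ₐ[k] Asanuma k p m r :=
  AdjoinRoot.ofAlgHom k (asanumaPoly k p m r)

/-- The generators: `none` is `y`, and `some j` are the variables of the base ring. -/
def gen : Option (Fin m ⊕ Fin 2) → Asanuma k p m r
  | none => AdjoinRoot.root _
  | some j => of k p m r (MvPolynomial.X j)

theorem mk_C (d : BaseRing k m) : mk k p m r (C d) = of k p m r d := rfl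

theorem mk_X : mk k p m r X = gen none := rfl

theorem of_X (j : Fin m ⊕ Fin 2) : of k p m r (MvPolynomial.X j) = gen (some j) := rfl

theorem mk_surjective : Function.Surjective (mk k p m r) := by
  intro a
  induction a using AdjoinRoot.induction_on with
  | ih q => exact ⟨q, rfl⟩

theorem mk_eq_zero {q : (BaseRing k m)[X]} :
    mk k p m r q = 0 ↔ asanumaPoly k p m r ∣ q := AdjoinRoot.mk_eq_zero

theorem of_injective : Function.Injective (of k p m r) := by
  refine AdjoinRoot.of.injective_of_degree_ne_zero ?_
  have : (asanumaPoly k p m r).degree = 1 := by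
    rw [asanumaPoly, sub_eq_add_neg, ← C_neg]
    exact degree_linear (pow_ne_zero _ prodX_ne_zero)
  simp [this]

theorem of_prodX : of k p m r (prodX k m) = ∏ i, gen (some (Sum.inl i)) := by
  simp [prodX, map_prod, of_X]

theorem of_line : of k p m r (line k m p) =
    lineEq p (gen (some (Sum.inr 0))) (gen (some (Sum.inr 1))) := by
  rw [line, map_lineEq, of_X, of_X]

theorem relation_of : of k p m r (prodX k m ^ r) * gen none = of k p m r (line k m p) := by
  rw [← sub_eq_zero, ← mk_X, ← mk_C, ← mk_C, ← map_mul, ← map_sub, mk_eq_zero]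
  rfl

variable (p r) in
/-- A family of elements satisfying the equation of the Asanuma ring. -/
def IsSolution {B : Type*} [CommRing B] (u : Option (Fin m ⊕ Fin 2) → B) : Prop :=
  (∏ i, u (some (Sum.inl i))) ^ r * u none =
    lineEq p (u (some (Sum.inr 0))) (u (some (Sum.inr 1)))

theorem isSolution_gen : IsSolution p r (gen : _ → Asanuma k p m r) := by
  rw [IsSolution, ← of_prodX, ← of_line, ← map_pow, relation_of]

variable {B : Type*} [CommRing B] [Algebra k B]

theorem IsSolution.map {B B' F : Type*} [CommRing B] [CommRing B'] [FunLike F B B']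
    [RingHomClass F B B'] (φ : F) {u : Option (Fin m ⊕ Fin 2) → B} (hu : IsSolution p r u) :
    IsSolution p r (fun o => φ (u o)) := by
  have := congrArg φ hu
  rwa [map_mul, map_pow, map_prod, map_lineEq] at this

/-- The universal property of the Asanuma ring. -/
def lift (u : Option (Fin m ⊕ Fin 2) → B) (hu : IsSolution p r u) :
    Asanuma k p m r →ₐ[k] B :=
  AdjoinRoot.liftAlgHom (asanumaPoly k p m r)
    (MvPolynomial.aeval fun j => u (some j)) (u none) (by
      rw [IsSolution, ← sub_eq_zero] at hu
      rw [asanumaPoly, ← coe_eval₂RingHom, map_sub, map_mul, coe_eval₂RingHom, eval₂_C,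
        eval₂_C, eval₂_X]
      simpa [prodX, line, map_lineEq, map_prod] using hu)

@[simp] theorem lift_gen (u : Option (Fin m ⊕ Fin 2) → B) (hu : IsSolution p r u)
    (o : Option (Fin m ⊕ Fin 2)) : lift (k := k) u hu (gen o) = u o := by
  cases o with
  | none => exact AdjoinRoot.liftAlgHom_root ..
  | some j =>
    refine (AdjoinRoot.liftAlgHom_of ..).trans ?_
    simp

theorem algHom_ext {φ ψ : Asanuma k p m r →ₐ[k] B} (h : ∀ o, φ (gen o) = ψ (gen o)) :
    φ = ψ := by
  refine AdjoinRoot.algHom_ext' (MvPolynomial.algHom_ext fun j => h (some j)) (h none)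

/-- A subalgebra containing the generators is everything. -/
theorem mem_of_gen_mem {S : Subalgebra k (Asanuma k p m r)} (h : ∀ o, gen o ∈ S)
    (a : Asanuma k p m r) : a ∈ S := by
  have hsol : IsSolution p r (fun o => (⟨gen o, h o⟩ : S)) := by
    have := isSolution_gen (k := k) (p := p) (m := m) (r := r)
    rw [IsSolution] at this ⊢
    apply Subtype.ext
    simpa [lineEq] using this
  have key : S.val.comp (lift _ hsol) = AlgHom.id k _ := algHom_ext (by simp)
  rw [← AlgHom.id_apply (R := k) a, ← key]
  exact Subtype.property _

/-- Every element becomes an element of the base ring after multiplication by a power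
of the coefficient of `y`. -/
theorem exists_pow_mul_eq_of (a : Asanuma k p m r) :
    ∃ N d, of k p m r (prodX k m ^ r) ^ N * a = of k p m r d := by
  obtain ⟨q, rfl⟩ := mk_surjective a
  induction q using Polynomial.induction_on with
  | C d => exact ⟨0, d, by simp [mk_C]⟩
  | add a b ha hb =>
    obtain ⟨N, d, h⟩ := ha
    obtain ⟨N', d', h'⟩ := hb
    refine ⟨N + N', (prodX k m ^ r) ^ N' * d + (prodX k m ^ r) ^ N * d', ?_⟩
    simp only [map_add, map_mul, map_pow] at h h' ⊢
    rw [← h, ← h']; ring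
  | monomial n d h =>
    obtain ⟨N, e, h⟩ := h
    refine ⟨N + 1, e * line k m p, ?_⟩
    rw [pow_succ X, ← mul_assoc, map_mul, mk_X, map_mul (of k p m r), ← h, ← relation_of]
    ring

end Basic

end Asanuma

/-- `y` is not a `p`-th power in the fraction field, not even up to sign: the `p`-th powers
of elements of `A` are independent over `1, y`. -/
def PowIndependent (p : ℕ) {A : Type*} [CommRing A] (y : A) : Prop :=
  ∀ a b : A, y * a ^ p + b ^ p = 0 → a = 0 ∧ b = 0

theorem PowIndependent.natDegree_eq {p : ℕ} {A : Type*} [CommRing A] {y : A}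
    (h : PowIndependent p y) (P Q : A[X]) :
    (C y * P ^ p + Q ^ p).natDegree = p * max P.natDegree Q.natDegree := by
  set d := max P.natDegree Q.natDegree with hd
  have hP : P.natDegree ≤ d := le_max_left _ _
  have hQ : Q.natDegree ≤ d := le_max_right _ _
  have hle : (C y * P ^ p + Q ^ p).natDegree ≤ p * d := by
    refine natDegree_add_le_of_degree_le ?_ ?_
    · exact (natDegree_C_mul_le _ _).trans (natDegree_pow_le_of_le p hP)
    · exact natDegree_pow_le_of_le p hQ
  rcases Nat.eq_zero_or_pos d with h0 | h0
  · rw [h0] at hle ⊢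
    simpa using hle
  refine le_antisymm hle (le_natDegree_of_ne_zero fun hc => ?_)
  rw [coeff_add, coeff_C_mul, coeff_pow_of_natDegree_le hP, coeff_pow_of_natDegree_le hQ] at hc
  obtain ⟨h1, h2⟩ := h _ _ hc
  rcases max_choice P.natDegree Q.natDegree with hm | hm
  · rw [hd, hm, coeff_natDegree, leadingCoeff_eq_zero] at h1
    rw [hd, hm, h1, natDegree_zero] at h0
    exact lt_irrefl _ h0
  · rw [hd, hm, coeff_natDegree, leadingCoeff_eq_zero] at h2
    rw [hd, hm, h2, natDegree_zero] at h0
    exact lt_irrefl _ h0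

/-- The curve `y M ^ (p ^ 2) = z ^ (p ^ 2) + t + t ^ (p ^ 2 + p)` has only constant
polynomial points. -/
theorem PowIndependent.natDegree_eq_zero_of_lineEq {p : ℕ} [hp : Fact p.Prime] {A : Type*}
    [CommRing A] [IsDomain A] [CharP A p] {y : A} (h : PowIndependent p y) {M z t : A[X]}
    (hM : M ≠ 0) (ht : t ≠ 0) (heq : C y * M ^ (p ^ 2) = lineEq p z t) :
    M.natDegree = 0 ∧ z.natDegree = 0 ∧ t.natDegree = 0 := by
  have hneg : ∀ a : A[X], (-a) ^ p = -a ^ p := fun a => map_neg (frobenius A[X] p) a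
  have hadd : ∀ a b : A[X], (a + b) ^ p = a ^ p + b ^ p := fun a b => add_pow_char a b p
  obtain ⟨n, hn⟩ : ∃ n : A[X], n = -(z ^ p + t ^ (p + 1)) := ⟨_, rfl⟩
  have h1 : t = C y * (M ^ p) ^ p + n ^ p := by
    rw [lineEq] at heq
    rw [hn, hneg, hadd, ← pow_mul, ← pow_mul, ← pow_mul, ← pow_two, heq]
    ring
  have h2 : n = C y * (-(t * M ^ p)) ^ p + (-(z + t * n)) ^ p := by
    rw [hneg, hneg, hadd, mul_pow, mul_pow]
    have : n = -(z ^ p + t ^ p * (C y * (M ^ p) ^ p + n ^ p)) := by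
      rw [← h1, hn, pow_succ]
    linear_combination this
  have d1 := h.natDegree_eq (M ^ p) n
  rw [← h1] at d1
  have d2 := h.natDegree_eq (-(t * M ^ p)) (-(z + t * n))
  rw [← h2, natDegree_neg, natDegree_neg, natDegree_mul ht (pow_ne_zero _ hM)] at d2
  rw [natDegree_pow] at d1 d2
  have h2p := hp.out.two_le
  have e1 : 2 * n.natDegree ≤ t.natDegree :=
    d1 ▸ Nat.mul_le_mul h2p (le_max_right _ _)
  have e2 : 2 * (t.natDegree + p * M.natDegree) ≤ n.natDegree :=
    (Nat.mul_le_mul h2p (le_max_left _ _)).trans d2.ge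
  have e3 : 2 * (z + t * n).natDegree ≤ n.natDegree :=
    (Nat.mul_le_mul h2p (le_max_right _ _)).trans d2.ge
  have e4 : 2 * M.natDegree ≤ p * M.natDegree := Nat.mul_le_mul_right _ h2p
  refine ⟨by omega, ?_, by omega⟩
  have hz : z = (z + t * n) - t * n := by ring
  have hb : (t * n).natDegree ≤ 0 := natDegree_mul_le.trans (by omega)
  have := natDegree_sub_le (z + t * n) (t * n)
  rw [← hz] at this
  omega

namespace Asanuma

variable {k : Type*} [Field k] {p m : ℕ}

theorem pderiv_line [CharP k p] [Fact p.Prime] :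
    MvPolynomial.pderiv (Sum.inr 1) (line k m p) = 1 := by
  have h0 : (0 : Fin 2) ≠ 1 := by decide
  simp [line, lineEq, Derivation.leibniz_pow, MvPolynomial.pderiv_X]

theorem pderiv_pow_char [CharP k p] (d : BaseRing k m) (j : Fin m ⊕ Fin 2) :
    MvPolynomial.pderiv j (d ^ p) = 0 := by
  simp [Derivation.leibniz_pow]

theorem powIndependent_y [CharP k p] [hp : Fact p.Prime] (s : ℕ) :
    PowIndependent p (gen none : Asanuma k p m (p * s)) := by
  have := isDomain (k := k) (m := m) (r := p * s) hp.out.ne_zero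
  have hπ : of k p m (p * s) (prodX k m ^ (p * s)) ≠ 0 := by
    rw [Ne, map_eq_zero_iff _ of_injective]
    exact pow_ne_zero _ prodX_ne_zero
  intro a b h
  obtain ⟨N, d, hd⟩ := exists_pow_mul_eq_of a
  obtain ⟨N', e, he⟩ := exists_pow_mul_eq_of b
  set π := prodX k m ^ (p * s) with hπdef
  set ν := prodX k m ^ s with hν
  have hπν : π = ν ^ p := by rw [hπdef, hν, ← pow_mul, mul_comm]
  have key : line k m p * (π ^ N' * d) ^ p + (ν * (π ^ N * e)) ^ p = 0 := by
    apply of_injective (k := k) (p := p) (m := m) (r := p * s)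
    rw [mul_pow ν, ← hπν]
    simp only [map_add, map_zero, map_mul, map_pow]
    rw [← hd, ← he, ← relation_of, ← hπdef]
    linear_combination (of k p m (p * s) π) * (of k p m (p * s) π ^ N) ^ p *
      (of k p m (p * s) π ^ N') ^ p * h
  have hd0 : d = 0 := by
    have h1 := congrArg (MvPolynomial.pderiv (Sum.inr 1)) key
    rw [map_add, Derivation.leibniz, pderiv_pow_char, pderiv_pow_char, pderiv_line, map_zero] at h1
    simpa [hπdef, hp.out.ne_zero, prodX_ne_zero] using h1
  have ha : a = 0 := by
    rw [hd0, map_zero] at hd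
    exact (mul_eq_zero.mp hd).resolve_left (pow_ne_zero _ hπ)
  refine ⟨ha, ?_⟩
  rw [ha, zero_pow hp.out.ne_zero, mul_zero, zero_add] at h
  exact pow_eq_zero_iff hp.out.ne_zero |>.mp h

instance [CharP k p] [Fact p.Prime] (r : ℕ) : CharP (Asanuma k p m r) p :=
  haveI := isDomain (k := k) (m := m) (r := r) (Fact.out : p.Prime).ne_zero
  charP_of_injective_algebraMap (algebraMap k _).injective p

end Asanuma

section AddMonoidAlgebra

open AddMonoidAlgebra

/-- The elements of nonnegative support. -/
def nonnegSupport (k B : Type*) [Field k] [CommRing B] [Algebra k B] : Subalgebra k B[ℚ] where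
  carrier := {h | ∀ e < 0, h.coeff e = 0}
  mul_mem' {x y} hx hy e he := by
    rw [AddMonoidAlgebra.coeff_mul]
    refine Finset.sum_eq_zero fun a _ => Finset.sum_eq_zero fun b _ => ?_
    dsimp only
    split_ifs with hab
    · rcases lt_or_ge a 0 with ha | ha
      · rw [hx a ha, zero_mul]
      · rw [hy b (by linarith), mul_zero]
    · rfl
  add_mem' {x y} hx hy e he := by simp [hx e he, hy e he]
  algebraMap_mem' c e he := by
    simp [coe_algebraMap, he.ne']

/-- The degree zero component, on the elements of nonnegative support. -/
def initialPart (k B : Type*) [Field k] [CommRing B] [Algebra k B] :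
    nonnegSupport k B →ₐ[k] B where
  toFun h := h.1.coeff 0
  map_one' := by simp
  map_zero' := by simp
  map_add' x y := by simp
  commutes' c := by
    simp [coe_algebraMap]
  map_mul' := by
    rintro ⟨x, hx⟩ ⟨y, hy⟩
    change (x * y).coeff 0 = _
    rw [AddMonoidAlgebra.coeff_mul, Finsupp.sum, Finset.sum_eq_single 0, Finsupp.sum,
      Finset.sum_eq_single 0]
    · simp
    · intro b _ hb
      simp [hb]
    · intro h
      simp [Finsupp.notMem_support_iff.mp h]
    · intro a _ ha
      refine Finset.sum_eq_zero fun b _ => ?_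
      dsimp only
      split_ifs with hab
      · rcases lt_or_gt_of_ne ha with h | h
        · rw [hx a h, zero_mul]
        · rw [hy b (by linarith), mul_zero]
      · rfl
    · intro h
      simp [Finsupp.notMem_support_iff.mp h]

end AddMonoidAlgebra

namespace Asanuma

section Grading

open AddMonoidAlgebra

variable {k : Type*} [Field k] {p m r : ℕ}

theorem IsSolution.torus {B : Type*} [CommRing B] {u v : Option (Fin m ⊕ Fin 2) → B}
    (hu : IsSolution p r u) (hv : (∏ i, v (some (Sum.inl i))) ^ r * v none = 1)
    (hv0 : ∀ j, v (some (Sum.inr j)) = 1) : IsSolution p r (fun o => v o * u o) := by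
  rw [IsSolution] at *
  rw [Finset.prod_mul_distrib, mul_pow, hv0, hv0, one_mul, one_mul, ← hu]
  linear_combination (∏ i, u (some (Sum.inl i))) ^ r * u none * hv

variable (r) in
/-- The weight of a generator for the grading attached to the `i`-th variable. -/
def wt (i : Fin m) : Option (Fin m ⊕ Fin 2) → ℚ
  | none => -r
  | some (Sum.inl j) => if j = i then 1 else 0
  | some (Sum.inr _) => 0

theorem wt_torus {B : Type*} [CommRing B] (i : Fin m) (c : ℚ) :
    (∏ j, (single (c * wt r i (some (Sum.inl j))) 1 : B[ℚ])) ^ r *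
      single (c * wt r i none) 1 = 1 := by
  rw [prod_single, single_pow, single_mul_single]
  simp [wt, one_def, mul_comm]

theorem IsSolution.shift {B : Type*} [CommRing B] {u : Option (Fin m ⊕ Fin 2) → B[ℚ]}
    (hu : IsSolution p r u) (i : Fin m) (c : ℚ) :
    IsSolution p r (fun o => single (c * wt r i o) 1 * u o) :=
  hu.torus (wt_torus i c) fun j => by simp [wt, one_def]

variable (k p r) in
/-- The grading of the Asanuma ring attached to the `i`-th variable. -/
def grading (i : Fin m) : Asanuma k p m r →ₐ[k] (Asanuma k p m r)[ℚ] :=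
  lift (fun o => single (1 * wt r i o) 1 * singleZeroRingHom (gen (r := r) o))
    ((isSolution_gen.map (singleZeroRingHom : Asanuma k p m r →+* (Asanuma k p m r)[ℚ])).shift i 1)

@[simp] theorem grading_gen (i : Fin m) (o : Option (Fin m ⊕ Fin 2)) :
    grading k p r i (gen o) = single (wt r i o) (gen o) := by
  simp [grading]

theorem grading_injective (i : Fin m) : Function.Injective (grading k p r i) := by
  let ε : (Asanuma k p m r)[ℚ] →ₐ[k] Asanuma k p m r :=
    liftNCAlgHom (AlgHom.id k _) 1 fun _ _ => Commute.all _ _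
  have h : ε.comp (grading k p r i) = AlgHom.id k _ := algHom_ext fun o => by simp [ε]
  exact Function.LeftInverse.injective (g := ε) fun a => congrArg (fun φ => φ a) h

theorem grading_of_monomial (i : Fin m) (s : Fin m ⊕ Fin 2 →₀ ℕ) (c : k) :
    grading k p r i (of k p m r (MvPolynomial.monomial s c)) =
      single (s (Sum.inl i) : ℚ) (of k p m r (MvPolynomial.monomial s c)) := by
  rw [MvPolynomial.monomial_eq, Finsupp.prod_fintype _ _ (by simp)]
  simp only [map_mul, map_prod, map_pow, of_X, grading_gen, single_pow, prod_single]
  have hc : MvPolynomial.C c = algebraMap k (BaseRing k m) c := rfl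
  rw [hc, AlgHom.commutes, AlgHom.commutes, coe_algebraMap, Function.comp_apply,
    single_mul_single]
  congr 1
  simp [wt]

theorem coeff_grading_of (i : Fin m) (d : BaseRing k m) (e : ℚ) :
    (grading k p r i (of k p m r d)).coeff e =
      of k p m r (∑ s ∈ d.support with (s (Sum.inl i) : ℚ) = e,
        MvPolynomial.monomial s (d.coeff s)) := by
  conv_lhs => rw [d.as_sum]
  simp only [map_sum, grading_of_monomial, AddMonoidAlgebra.coeff_sum, Finset.sum_filter,
    Finsupp.finsetSum_apply, coeff_single, Finsupp.single_apply, apply_ite (of k p m r), map_zero]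

theorem prodX_pow_dvd {d : BaseRing k m} {N : ℕ}
    (h : ∀ s ∈ d.support, ∀ i, N ≤ s (Sum.inl i)) : prodX k m ^ N ∣ d := by
  rw [d.as_sum]
  refine Finset.dvd_sum fun s hs => ?_
  rw [MvPolynomial.monomial_eq, Finsupp.prod_fintype _ _ (by simp), Fintype.prod_sum_type, prodX,
    ← Finset.prod_pow]
  refine Dvd.dvd.mul_left (Dvd.dvd.mul_right (Finset.prod_dvd_prod_of_dvd _ _ fun i _ => ?_) _) _
  exact pow_dvd_pow _ (h s hs i)

/-- An element all of whose gradings have nonnegative support comes from the base ring. -/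
theorem mem_range_of (hp : p ≠ 0) {g : Asanuma k p m r}
    (h : ∀ i, ∀ e < 0, (grading k p r i g).coeff e = 0) : g ∈ (of k p m r).range := by
  have := isDomain (k := k) (m := m) (r := r) hp
  obtain ⟨N, d, hd⟩ := exists_pow_mul_eq_of g
  have hdvd : prodX k m ^ (r * N) ∣ d := by
    refine prodX_pow_dvd fun s hs i => ?_
    by_contra! hlt
    have h1 : (grading k p r i (of k p m r d)).coeff (s (Sum.inl i)) = 0 := by
      rw [← hd, map_mul, map_pow, map_pow, map_pow, of_prodX, map_prod]
      simp only [grading_gen, prod_single, single_pow]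
      rw [coeff_single_mul_apply, h, mul_zero]
      have : (s (Sum.inl i) : ℚ) < (r * N : ℕ) := by exact_mod_cast hlt
      simp only [wt, Finset.sum_ite_eq', Finset.mem_univ, if_true, nsmul_eq_mul, mul_one]
      push_cast at this
      linarith
    rw [coeff_grading_of, map_eq_zero_iff _ of_injective] at h1
    have h2 := congrArg (MvPolynomial.coeff s) h1
    rw [MvPolynomial.coeff_sum, Finset.sum_eq_single s] at h2
    · simp at h2
      exact (MvPolynomial.mem_support_iff.mp hs) h2
    · intro b _ hb
      simp [hb]
    · intro hs'
      simp at hs'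
      simp [hs']
  obtain ⟨d', rfl⟩ := hdvd
  refine ⟨d', ?_⟩
  rw [map_mul, pow_mul, map_pow (of k p m r) (prodX k m ^ r)] at hd
  refine (mul_left_cancel₀ (pow_ne_zero _ ?_) hd).symm
  rw [Ne, map_eq_zero_iff _ of_injective]
  exact pow_ne_zero _ prodX_ne_zero

/-- The components of negative degree are divisible by `y`. -/
theorem dvd_coeff_grading (i : Fin m) (a : Asanuma k p m r) :
    ∀ e < 0, gen none ∣ (grading k p r i a).coeff e := by
  let S : Subalgebra k (Asanuma k p m r) :=
    { carrier := {a | ∀ e < 0, gen none ∣ (grading k p r i a).coeff e}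
      mul_mem' := by
        intro a b ha hb e he
        rw [map_mul, AddMonoidAlgebra.coeff_mul]
        refine Finset.dvd_sum fun x _ => Finset.dvd_sum fun y _ => ?_
        dsimp only
        split_ifs with hxy
        · rcases lt_or_ge x 0 with hx | hx
          · exact (ha x hx).mul_right _
          · exact (hb y (by linarith)).mul_left _
        · exact dvd_zero _
      add_mem' := by
        intro a b ha hb e he
        rw [map_add, AddMonoidAlgebra.coeff_add, Finsupp.add_apply]
        exact dvd_add (ha e he) (hb e he)
      algebraMap_mem' := by
        intro c e he
        rw [AlgHom.commutes, coe_algebraMap, Function.comp_apply, coeff_single,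
          Finsupp.single_eq_of_ne he.ne]
        exact dvd_zero _ }
  refine mem_of_gen_mem (S := S) (fun o e he => ?_) a
  rw [grading_gen, coeff_single, Finsupp.single_apply]
  split_ifs with h
  · match o with
    | none => exact dvd_rfl
    | some (Sum.inl j) =>
      simp only [wt] at h
      split_ifs at h <;> linarith
    | some (Sum.inr j) =>
      simp only [wt] at h
      linarith
  · exact dvd_zero _

end Grading

section Deform

open AddMonoidAlgebra

variable {k : Type*} [Field k] {p m r : ℕ}

/-- The grading extended to `A[U]`, with `U` of degree `ω`. -/
def gradingX (i : Fin m) (ω : ℚ) : (Asanuma k p m r)[X] →ₐ[k] (Asanuma k p m r)[X][ℚ] :=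
  eval₂AlgHom ((AddMonoidAlgebra.mapAlgHom ℚ (CAlgHom (R := k))).comp (grading k p r i))
    (single ω X)
    fun _ => Commute.all _ _

theorem gradingX_C (i : Fin m) (ω : ℚ) (a : Asanuma k p m r) (e : ℚ) :
    (gradingX i ω (C a)).coeff e = C ((grading k p r i a).coeff e) := by
  simp only [gradingX, eval₂AlgHom_apply, eval₂_C]
  exact AddMonoidAlgebra.coeff_mapRingHom (C : Asanuma k p m r →+* _) _ _

theorem coeff_gradingX (i : Fin m) (ω : ℚ) (P : (Asanuma k p m r)[X]) (e : ℚ) (j : ℕ) :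
    ((gradingX i ω P).coeff e).coeff j = (grading k p r i (P.coeff j)).coeff (e - j * ω) := by
  induction P using Polynomial.induction_on' with
  | add P Q hP hQ => simp [hP, hQ]
  | monomial l a =>
    have hX : gradingX (k := k) (p := p) (r := r) i ω X = single ω X := by simp [gradingX]
    rw [← C_mul_X_pow_eq_monomial, map_mul, map_pow, hX, single_pow, coeff_mul_single_apply,
      gradingX_C, coeff_C_mul_X_pow, coeff_C_mul_X_pow]
    split_ifs with h
    · simp [h, sub_eq_add_neg]
    · simp

/-- The homomorphism `φ` in degrees shifted by the weights of the generators. -/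
def shifted (i : Fin m) (ω : ℚ) (φ : Asanuma k p m r →ₐ[k] (Asanuma k p m r)[X]) :
    Asanuma k p m r →ₐ[k] (Asanuma k p m r)[X][ℚ] :=
  lift (fun o => single (-1 * wt r i o) 1 * gradingX i ω (φ (gen o)))
    ((isSolution_gen.map ((gradingX i ω).comp φ)).shift i (-1))

theorem shifted_gen (i : Fin m) (ω : ℚ) (φ : Asanuma k p m r →ₐ[k] (Asanuma k p m r)[X])
    (o : Option (Fin m ⊕ Fin 2)) :
    shifted i ω φ (gen o) = single (-1 * wt r i o) 1 * gradingX i ω (φ (gen o)) :=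
  lift_gen _ _ _

theorem coeff_shifted_gen (i : Fin m) (ω : ℚ)
    (φ : Asanuma k p m r →ₐ[k] (Asanuma k p m r)[X]) (o : Option (Fin m ⊕ Fin 2)) (e : ℚ)
    (j : ℕ) : ((shifted i ω φ (gen o)).coeff e).coeff j =
      (grading k p r i ((φ (gen o)).coeff j)).coeff (e + wt r i o - j * ω) := by
  rw [shifted_gen, coeff_single_mul_apply, one_mul, coeff_gradingX]
  congr 1
  ring

/-- `φ` is recovered from its shifted version through the grading. -/
theorem gradingX_apply (i : Fin m) (ω : ℚ) (φ : Asanuma k p m r →ₐ[k] (Asanuma k p m r)[X])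
    (a : Asanuma k p m r) :
    gradingX i ω (φ a) = (grading k p r i a).coeff.sum fun q b =>
      shifted i ω φ b * single q 1 := by
  let T : Multiplicative ℚ →* (Asanuma k p m r)[X][ℚ] := AddMonoidAlgebra.of _ _
  let E : (Asanuma k p m r)[ℚ] →ₐ[k] (Asanuma k p m r)[X][ℚ] :=
    liftNCAlgHom (shifted i ω φ) T fun _ _ => Commute.all _ _
  have hE : ∀ q b, E (single q b) = shifted i ω φ b * single q 1 := fun q b => by
    simp [E, T]
  have h : (gradingX i ω).comp φ = E.comp (grading k p r i) := algHom_ext fun o => by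
    rw [AlgHom.comp_apply, AlgHom.comp_apply, grading_gen, hE, shifted_gen, mul_right_comm,
      single_mul_single]
    simp [← one_def]
  have h' := congrArg (fun ψ => ψ a) h
  simp only [AlgHom.comp_apply] at h'
  rw [h']
  conv_lhs => rw [← AddMonoidAlgebra.sum_coeff_single (grading k p r i a)]
  rw [Finsupp.sum, map_sum]
  exact Finset.sum_congr rfl fun q _ => hE _ _

/-- The slope of a nontrivial deformation. -/
theorem exists_slope (i : Fin m) (φ : Asanuma k p m r →ₐ[k] (Asanuma k p m r)[X])
    (hnt : ∃ o, (φ (gen o)).natDegree ≠ 0) : ∃ ω : ℚ,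
    (∀ o j q, j ≠ 0 → (grading k p r i ((φ (gen o)).coeff j)).coeff q ≠ 0 →
      wt r i o ≤ q + j * ω) ∧
    ∃ o j, j ≠ 0 ∧
      (grading k p r i ((φ (gen o)).coeff j)).coeff (wt r i o - j * ω) ≠ 0 := by
  classical
  let S : Finset (Option (Fin m ⊕ Fin 2) × ℕ × ℚ) := Finset.univ.biUnion fun o =>
    ((φ (gen o)).support.erase 0).biUnion fun j =>
      (grading k p r i ((φ (gen o)).coeff j)).coeff.support.image fun q => (o, j, q)
  have hS : ∀ o j q, (o, j, q) ∈ S ↔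
      j ≠ 0 ∧ (grading k p r i ((φ (gen o)).coeff j)).coeff q ≠ 0 := by
    intro o j q
    simp only [S, Finset.mem_biUnion, Finset.mem_univ, true_and, Finset.mem_image,
      Finset.mem_erase, Prod.mk.injEq, Finsupp.mem_support_iff, mem_support_iff]
    constructor
    · rintro ⟨_, _, ⟨h1, _⟩, _, h3, rfl, rfl, rfl⟩
      exact ⟨h1, h3⟩
    · rintro ⟨h1, h2⟩
      refine ⟨o, j, ⟨h1, fun h0 => h2 ?_⟩, q, h2, rfl, rfl, rfl⟩
      rw [h0]; simp
  have hne : S.Nonempty := by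
    obtain ⟨o, ho⟩ := hnt
    have h1 : grading k p r i ((φ (gen o)).coeff (φ (gen o)).natDegree) ≠ 0 := by
      rw [Ne, map_eq_zero_iff _ (grading_injective i), coeff_natDegree,
        Polynomial.leadingCoeff_eq_zero]
      rintro h0
      simp [h0] at ho
    have h2 : (grading k p r i ((φ (gen o)).coeff (φ (gen o)).natDegree)).coeff ≠ 0 := by
      rwa [Ne, AddMonoidAlgebra.coeff_eq_zero]
    obtain ⟨q, hq⟩ := Finsupp.ne_iff.mp h2
    exact ⟨(o, _, q), (hS _ _ _).mpr ⟨ho, hq⟩⟩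
  obtain ⟨⟨o, j, q⟩, hmem, hmax⟩ :=
    S.exists_max_image (fun x => (wt r i x.1 - x.2.2) / x.2.1) hne
  refine ⟨(wt r i o - q) / j, fun o' j' q' hj' hq' => ?_, o, j, ((hS _ _ _).mp hmem).1, ?_⟩
  · have := hmax (o', j', q') ((hS _ _ _).mpr ⟨hj', hq'⟩)
    dsimp only at this
    have hpos : (0 : ℚ) < j' := by positivity
    rw [div_le_iff₀ hpos] at this
    linarith
  · obtain ⟨hj, hq⟩ := (hS _ _ _).mp hmem
    have : (j : ℚ) ≠ 0 := by exact_mod_cast hj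
    rwa [mul_div_cancel₀ _ this, sub_sub_cancel]

variable [CharP k p] [hp : Fact p.Prime] {s : ℕ}

/-- An element fixed by a nontrivial deformation comes from the base ring. -/
theorem mem_range_of_of_fixed (hs : s ≠ 0) (hr : r = p ^ 2 * s)
    (φ : Asanuma k p m r →ₐ[k] (Asanuma k p m r)[X])
    (h0 : ∀ a, (φ a).coeff 0 = a) (hnt : ∃ o, (φ (gen o)).natDegree ≠ 0)
    {g : Asanuma k p m r} (hg : φ g = C g) : g ∈ (of k p m r).range := by
  have := isDomain (k := k) (m := m) (r := r) hp.out.ne_zero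
  refine mem_range_of hp.out.ne_zero fun i => ?_
  by_contra! hneg
  obtain ⟨e₀, he₀, hge₀⟩ := hneg
  obtain ⟨q, hq, hqmin⟩ := (grading k p _ i g).coeff.support.exists_min_image id
    ⟨e₀, Finsupp.mem_support_iff.mpr hge₀⟩
  have hq0 : q < 0 := (hqmin e₀ (Finsupp.mem_support_iff.mpr hge₀)).trans_lt he₀
  rw [Finsupp.mem_support_iff] at hq
  obtain ⟨ω, hω, o₁, j₁, hj₁, hne₁⟩ := exists_slope i φ hnt
  have hmem : ∀ a, shifted i ω φ a ∈ nonnegSupport k (Asanuma k p m r)[X] := by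
    refine fun a => mem_of_gen_mem (S := (nonnegSupport k _).comap (shifted i ω φ))
      (fun o e he => ?_) a
    ext j
    change ((shifted i ω φ (gen o)).coeff e).coeff j = _
    rw [coeff_shifted_gen, Polynomial.coeff_zero]
    rcases eq_or_ne j 0 with rfl | hj
    · rw [h0, grading_gen, coeff_single, Finsupp.single_eq_of_ne]
      simpa using he.ne
    · by_contra hc
      have := hω o j _ hj hc
      linarith
  let Φ : Asanuma k p m r →ₐ[k] (Asanuma k p m r)[X] :=
    (initialPart k _).comp ((shifted i ω φ).codRestrict _ hmem)
  have hΦ : ∀ a, Φ a = (shifted i ω φ a).coeff 0 := fun a => rfl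
  have hΦ0 : ∀ o, (Φ (gen o)).coeff 0 = gen o := fun o => by
    rw [hΦ, coeff_shifted_gen, h0, grading_gen, coeff_single]
    simp
  have hΦne : ∀ o, Φ (gen o) ≠ 0 := fun o h => by
    have h1 := hΦ0 o
    rw [h, Polynomial.coeff_zero] at h1
    match o with
    | some j =>
      rw [← of_X, eq_comm, map_eq_zero_iff _ of_injective] at h1
      exact MvPolynomial.X_ne_zero _ h1
    | none =>
      have h2 := relation_of (k := k) (p := p) (m := m) (r := r)
      rw [← h1, mul_zero, eq_comm, map_eq_zero_iff _ of_injective] at h2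
      have h3 := pderiv_line (k := k) (p := p) (m := m)
      rw [h2, map_zero] at h3
      exact zero_ne_one h3
  obtain ⟨b, hb⟩ := dvd_coeff_grading i g q hq0
  have hfix : Φ ((grading k p _ i g).coeff q) = C ((grading k p _ i g).coeff q) := by
    have h1 := gradingX_apply i ω φ g
    rw [hg] at h1
    have h2 := congrArg (fun h => h.coeff q) h1
    simp only [gradingX_C, Finsupp.sum, AddMonoidAlgebra.coeff_sum, Finsupp.finsetSum_apply] at h2
    rw [h2, hΦ, Finset.sum_eq_single q]
    · rw [coeff_mul_single_apply, add_neg_cancel, mul_one]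
    · intro q' hq' hne
      rw [coeff_mul_single_apply, mul_one]
      have := lt_of_le_of_ne (hqmin q' hq') (Ne.symm hne)
      exact hmem _ _ (by simp only [id] at this; linarith)
    · intro h
      exact absurd (Finsupp.notMem_support_iff.mp h) hq
  have hy : Φ (gen none) = C (gen none) := by
    have h1 : (Φ (gen none)).natDegree = 0 := by
      rw [hb, map_mul] at hfix
      have h2 := congrArg natDegree hfix
      have hprod : Φ (gen none) * Φ b ≠ 0 := by
        rw [hfix, Ne, C_eq_zero, ← hb]
        exact hq
      rw [natDegree_C, natDegree_mul (left_ne_zero_of_mul hprod)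
        (right_ne_zero_of_mul hprod)] at h2
      omega
    rw [eq_C_of_natDegree_eq_zero h1, hΦ0]
  have hsol := (isSolution_gen (k := k) (p := p) (m := m) (r := r)).map Φ
  have hpow : ∀ x : (Asanuma k p m r)[X], x ^ r = (x ^ s) ^ (p ^ 2) := fun x => by
    rw [← pow_mul, mul_comm s, ← hr]
  rw [IsSolution, hy, hpow, mul_comm] at hsol
  have hprod : ∏ j, Φ (gen (some (Sum.inl j))) ≠ 0 := Finset.prod_ne_zero_iff.mpr fun _ _ => hΦne _
  have hind : PowIndependent p (gen none : Asanuma k p m r) := by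
    have := powIndependent_y (k := k) (p := p) (m := m) (p * s)
    rwa [← mul_assoc, ← pow_two, ← hr] at this
  obtain ⟨hM, hz, ht⟩ := hind.natDegree_eq_zero_of_lineEq (pow_ne_zero s hprod) (hΦne _) hsol
  rw [natDegree_pow, natDegree_prod _ _ fun _ _ => hΦne _] at hM
  have hx := (mul_eq_zero.mp hM).resolve_left hs
  rw [Finset.sum_eq_zero_iff] at hx
  have hall : ∀ o, (Φ (gen o)).natDegree = 0 := by
    intro o
    match o with
    | none => rw [hy, natDegree_C]
    | some (Sum.inl j) => exact hx j (Finset.mem_univ _)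
    | some (Sum.inr 0) => exact hz
    | some (Sum.inr 1) => exact ht
  have h1 : (Φ (gen o₁)).coeff j₁ = 0 :=
    coeff_eq_zero_of_natDegree_lt (by rw [hall]; exact Nat.pos_of_ne_zero hj₁)
  rw [hΦ, coeff_shifted_gen, zero_add] at h1
  exact hne₁ h1

end Deform

section Isomorphisms

theorem dvd_lineEq_sub {p : ℕ} {R : Type*} [CommRing R] {π z z' t t' : R} (hz : π ∣ z' - z)
    (ht : π ∣ t' - t) : π ∣ lineEq p z' t' - lineEq p z t := by
  have h1 := hz.trans (sub_dvd_pow_sub_pow z' z (p ^ 2))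
  have h2 := ht.trans (sub_dvd_pow_sub_pow t' t (p ^ 2 + p))
  have : lineEq p z' t' - lineEq p z t =
      (z' ^ p ^ 2 - z ^ p ^ 2) + (t' - t) + (t' ^ (p ^ 2 + p) - t ^ (p ^ 2 + p)) := by
    simp only [lineEq]; ring
  rw [this]
  exact dvd_add (dvd_add h1 ht) h2

variable {k : Type*} [Field k] {p m r : ℕ}

/-- For each of the variables `z`, `t`, there is a deformation moving it and fixing the
other variables of the base ring. -/
theorem exists_deformation (hp : p ≠ 0) (j : Fin 2) :
    ∃ φ : Asanuma k p m r →ₐ[k] (Asanuma k p m r)[X], (∀ a, (φ a).coeff 0 = a) ∧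
      (∀ l ≠ Sum.inr j, φ (gen (some l)) = C (gen (some l))) ∧
      (φ (gen (some (Sum.inr j)))).natDegree ≠ 0 := by
  have := isDomain (k := k) (m := m) (r := r) hp
  set π := of k p m r (prodX k m ^ r) with hπ
  have hπ0 : π ≠ 0 := by
    rw [Ne, map_eq_zero_iff _ of_injective]
    exact pow_ne_zero _ prodX_ne_zero
  let w : Fin 2 → (Asanuma k p m r)[X] := Pi.single j X
  have hw : ∀ l, (w l).coeff 0 = 0 := fun l => by
    by_cases h : l = j
    · subst h; simp [w]
    · simp [w, h]
  let v : Fin 2 → (Asanuma k p m r)[X] := fun l => C (gen (some (Sum.inr l))) + C π * w l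
  have hdvd : C π ∣ lineEq p (v 0) (v 1) -
      lineEq p (C (gen (some (Sum.inr 0)))) (C (gen (some (Sum.inr 1)))) := by
    refine dvd_lineEq_sub ⟨w 0, ?_⟩ ⟨w 1, ?_⟩ <;> simp [v]
  obtain ⟨q, hq⟩ := hdvd
  have hq0 : q.coeff 0 = 0 := by
    have h1 := congrArg (fun P => P.coeff 0) hq
    simp only [coeff_zero_eq_eval_zero, ← coe_evalRingHom] at h1
    rw [map_sub, map_lineEq, map_lineEq] at h1
    simp only [coe_evalRingHom, ← coeff_zero_eq_eval_zero] at h1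
    simp only [v, coeff_add, coeff_C_mul, hw, mul_zero, add_zero, sub_self, coeff_C_zero] at h1
    exact (mul_eq_zero.mp h1.symm).resolve_left hπ0
  let u : Option (Fin m ⊕ Fin 2) → (Asanuma k p m r)[X]
    | none => C (gen none) + q
    | some (Sum.inl i) => C (gen (some (Sum.inl i)))
    | some (Sum.inr l) => v l
  have hu : IsSolution p r u := by
    have h1 : C π * C (gen none) = lineEq p (C (gen (some (Sum.inr 0))))
      (C (gen (some (Sum.inr 1)) : Asanuma k p m r)) := by
      rw [← map_lineEq, ← of_line, ← relation_of, C_mul]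
    have h2 : (∏ i, u (some (Sum.inl i))) ^ r = C π := by
      simp [u, hπ, map_pow, of_prodX, map_prod]
    rw [IsSolution, h2]
    linear_combination h1 - hq
  refine ⟨lift u hu, fun a => ?_, fun l hl => ?_, ?_⟩
  · have h1 : ((aeval (0 : Asanuma k p m r)).restrictScalars k).comp (lift u hu) =
        AlgHom.id k _ := algHom_ext fun o => by
      rw [AlgHom.comp_apply, lift_gen, AlgHom.restrictScalars_apply, coe_aeval_eq_eval,
        ← coeff_zero_eq_eval_zero]
      match o with
      | none => simp [u, hq0]
      | some (Sum.inl i) => simp [u]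
      | some (Sum.inr l) => simp [u, v, hw]
    have h2 := congrArg (fun ψ => ψ a) h1
    simpa [coe_aeval_eq_eval, coeff_zero_eq_eval_zero] using h2
  · rw [lift_gen]
    match l with
    | Sum.inl i => rfl
    | Sum.inr l =>
      have : l ≠ j := fun h => hl (h ▸ rfl)
      simp [u, v, w, this]
  · rw [lift_gen]
    simp [u, v, w, natDegree_C_mul hπ0]

variable {r' : ℕ}

/-- The derivative with respect to `y` of an element of the defining ideal. -/
theorem dvd_mk_derivative {q : (BaseRing k m)[X]} (h : mk k p m r q = 0) :
    of k p m r (prodX k m ^ r) ∣ mk k p m r (derivative q) := by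
  obtain ⟨q', rfl⟩ := mk_eq_zero.mp h
  have h1 : mk k p m r (asanumaPoly k p m r) = 0 := mk_eq_zero.mpr dvd_rfl
  rw [derivative_mul, map_add, map_mul, map_mul, h1, zero_mul, add_zero]
  have h2 : mk k p m r (derivative (asanumaPoly k p m r)) = of k p m r (prodX k m ^ r) := by
    rw [asanumaPoly, derivative_sub, derivative_C_mul, derivative_X, derivative_C, mul_one,
      sub_zero, mk_C]
  rw [h2]
  exact dvd_mul_right _ _

theorem dvd_of_base_map (Φ : Asanuma k p m r' ≃ₐ[k] Asanuma k p m r)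
    (θ : BaseRing k m →ₐ[k] BaseRing k m) (hθ : ∀ d, Φ (of k p m r' d) = of k p m r (θ d)) :
    of k p m r (prodX k m ^ r) ∣ Φ (of k p m r' (prodX k m ^ r')) := by
  obtain ⟨H, hH⟩ := mk_surjective (Φ (gen none))
  obtain ⟨K, hK⟩ := mk_surjective (Φ.symm (gen none))
  have hcomp : mk k p m r ((K.map (θ : BaseRing k m →+* BaseRing k m)).comp H - X) = 0 := by
    have h1 : mk k p m r ((K.map (θ : BaseRing k m →+* BaseRing k m)).comp H) =
        Φ (mk k p m r' K) := by
      clear hK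
      induction K using Polynomial.induction_on' with
      | add P Q hP hQ => rw [Polynomial.map_add, add_comp, map_add, hP, hQ, map_add, map_add]
      | monomial n d =>
        rw [← C_mul_X_pow_eq_monomial, Polynomial.map_mul, map_C, Polynomial.map_pow, map_X,
          mul_comp, C_comp, X_pow_comp, map_mul, map_pow, map_mul, map_pow, map_mul, map_pow,
          mk_C, mk_C, mk_X, hθ, hH]
        rfl
    rw [map_sub, h1, hK, mk_X]
    simp
  have hrel : mk k p m r (C (θ (prodX k m ^ r')) * H - C (θ (line k m p))) = 0 := by
    rw [map_sub, map_mul, mk_C, mk_C, ← hθ, ← hθ, hH, ← map_mul, relation_of, sub_self]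
  have d1 := dvd_mk_derivative hcomp
  have d2 := dvd_mk_derivative hrel
  rw [derivative_sub, derivative_comp, derivative_X, map_sub, map_mul, map_one] at d1
  rw [derivative_sub, derivative_C_mul, derivative_C, sub_zero, map_mul, mk_C, ← hθ] at d2
  obtain ⟨a, ha⟩ := d1
  obtain ⟨b, hb⟩ := d2
  set A := mk k p m r ((derivative (K.map (θ : BaseRing k m →+* BaseRing k m))).comp H)
  refine ⟨A * b - Φ (of k p m r' (prodX k m ^ r')) * a, ?_⟩
  linear_combination A * hb - Φ (of k p m r' (prodX k m ^ r')) * ha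

theorem exists_algebraMap_eq_of_isUnit {A σ : Type*} [CommRing A] [Algebra k A]
    (e : A[X] ≃ₐ[k] MvPolynomial σ k) {u : A} (hu : IsUnit u) : ∃ c, algebraMap k A c = u := by
  have h1 : IsUnit (e (C u)) := (hu.map C).map e
  obtain ⟨c, hc⟩ := (MvPolynomial.isUnit_iff_eq_C_of_isReduced.mp h1)
  refine ⟨c, C_injective (R := A) ?_⟩
  apply e.injective
  rw [hc.2]
  exact e.commutes c

theorem emultiplicity_prodX (i : Fin m) :
    emultiplicity (MvPolynomial.X (Sum.inl i)) (prodX k m) = 1 := by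
  rw [prodX, Finset.emultiplicity_prod (prime_X i), Finset.sum_eq_single i]
  · have h := (FiniteMultiplicity.of_prime_left (prime_X i)
      (MvPolynomial.X_ne_zero (R := k) (Sum.inl i))).emultiplicity_self
    exact h
  · intro j _ hj
    rw [emultiplicity_eq_zero, MvPolynomial.X_dvd_X]
    simp [hj.symm]
  · simp

variable [CharP k p] [hp : Fact p.Prime] {s : ℕ}

/-- Isomorphisms of Asanuma rings preserve the base ring. -/
theorem exists_base_map (hs : s ≠ 0) (hr : r = p ^ 2 * s)
    (Φ : Asanuma k p m r' ≃ₐ[k] Asanuma k p m r) :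
    ∃ θ : BaseRing k m →ₐ[k] BaseRing k m, ∀ d, Φ (of k p m r' d) = of k p m r (θ d) := by
  have key : ∀ l : Fin m ⊕ Fin 2, ∃ d, of k p m r d = Φ (gen (some l)) := by
    intro l
    obtain ⟨j, hj⟩ : ∃ j : Fin 2, l ≠ Sum.inr j := by
      by_cases h : l = Sum.inr 0
      · exact ⟨1, by simp [h]⟩
      · exact ⟨0, h⟩
    obtain ⟨φ, h0, hfix, hnt⟩ := exists_deformation (k := k) (m := m) (r := r') hp.out.ne_zero j
    let Ψ : Asanuma k p m r →ₐ[k] (Asanuma k p m r)[X] :=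
      ((mapAlgHom (Φ : Asanuma k p m r' →ₐ[k] Asanuma k p m r)).comp φ).comp
        (Φ.symm : Asanuma k p m r →ₐ[k] Asanuma k p m r')
    have hΨ : ∀ a, Ψ (Φ a) = (φ a).map (Φ : Asanuma k p m r' →ₐ[k] Asanuma k p m r) :=
      fun a => by simp [Ψ]
    have hΨ0 : ∀ a, (Ψ a).coeff 0 = a := fun a => by
      obtain ⟨a, rfl⟩ := Φ.surjective a
      rw [hΨ, coeff_map, h0]
      rfl
    refine mem_range_of_of_fixed hs hr Ψ hΨ0 ?_ ?_
    · by_contra! hc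
      have h1 : Ψ = CAlgHom := algHom_ext fun o => by
        rw [eq_C_of_natDegree_eq_zero (hc o), hΨ0, CAlgHom_apply]
      refine hnt ?_
      have h2 := hΨ (gen (some (Sum.inr j)))
      rw [h1, CAlgHom_apply] at h2
      have h3 := congrArg natDegree h2
      rw [natDegree_C, natDegree_map_eq_of_injective Φ.injective] at h3
      exact h3.symm
    · rw [hΨ, hfix l hj, map_C]
      rfl
  choose d hd using key
  refine ⟨MvPolynomial.aeval d, fun e => ?_⟩
  have : (Φ : Asanuma k p m r' →ₐ[k] Asanuma k p m r).comp (of k p m r') =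
      (of k p m r).comp (MvPolynomial.aeval d) := MvPolynomial.algHom_ext fun l => by
    simp [of_X, hd]
  exact congrArg (fun ψ => ψ e) this

theorem dvd_of_algEquiv {s' : ℕ} (hm : m ≠ 0) (hs : s ≠ 0) (hs' : s' ≠ 0) (hr : r = p ^ 2 * s)
    (hr' : r' = p ^ 2 * s') {σ : Type*} (e : (Asanuma k p m r)[X] ≃ₐ[k] MvPolynomial σ k)
    (Φ : Asanuma k p m r' ≃ₐ[k] Asanuma k p m r) : r' ∣ r := by
  have := isDomain (k := k) (m := m) (r := r) hp.out.ne_zero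
  obtain ⟨θ, hθ⟩ := exists_base_map hs hr Φ
  obtain ⟨θ', hθ'⟩ := exists_base_map hs' hr' Φ.symm
  have h1 := dvd_of_base_map Φ θ hθ
  have h2 := map_dvd Φ (dvd_of_base_map Φ.symm θ' hθ')
  rw [AlgEquiv.apply_symm_apply] at h2
  obtain ⟨u, hu⟩ := associated_of_dvd_dvd h1 h2
  obtain ⟨c, hc⟩ := exists_algebraMap_eq_of_isUnit e u.isUnit
  rw [← hc, hθ, ← (of k p m r).commutes c, ← map_mul] at hu
  have hu' := of_injective hu
  have hc0 : IsUnit (algebraMap k (BaseRing k m) c) := by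
    refine IsUnit.map _ (IsUnit.mk0 _ ?_)
    rintro rfl
    rw [map_zero] at hc
    exact u.isUnit.ne_zero hc.symm
  have i : Fin m := ⟨0, Nat.pos_of_ne_zero hm⟩
  have h3 := congrArg (emultiplicity (MvPolynomial.X (Sum.inl i) : BaseRing k m)) hu'
  rw [map_pow, emultiplicity_mul (prime_X i), emultiplicity_pow (prime_X i),
    emultiplicity_pow (prime_X i), emultiplicity_prodX,
    emultiplicity_of_isUnit_right (prime_X i).not_isUnit hc0, add_zero, mul_one] at h3
  have hr0 : r' ≠ 0 := hr' ▸ mul_ne_zero (pow_ne_zero _ hp.out.ne_zero) hs'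
  cases h4 : emultiplicity (MvPolynomial.X (Sum.inl i) : BaseRing k m) (θ (prodX k m)) with
  | top =>
    rw [h4, ENat.mul_top (by exact_mod_cast hr0)] at h3
    exact absurd h3 (ENat.natCast_ne_top r)
  | coe n =>
    rw [h4] at h3
    exact ⟨n, by exact_mod_cast h3⟩

end Isomorphisms

section StableIsomorphism

variable {R : Type*} [CommRing R]

/-- A left inverse on the line of the parametrization
`w ↦ (w - w ^ (p ^ 2 + p), - w ^ (p ^ 2))`. -/
def lineCoord (p : ℕ) (z t : R) : R := z + (z ^ p + t ^ (p + 1)) ^ (p + 1)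

theorem map_lineCoord (p : ℕ) {S F : Type*} [CommRing S] [FunLike F R S]
    [RingHomClass F R S] (φ : F) (z t : R) : φ (lineCoord p z t) = lineCoord p (φ z) (φ t) := by
  simp [lineCoord]

theorem dvd_lineCoord_sub {p : ℕ} {π z z' t t' : R} (hz : π ∣ z' - z) (ht : π ∣ t' - t) :
    π ∣ lineCoord p z' t' - lineCoord p z t := by
  have h1 := hz.trans (sub_dvd_pow_sub_pow z' z p)
  have h2 := ht.trans (sub_dvd_pow_sub_pow t' t (p + 1))
  have h3 := (dvd_add h1 h2).trans ((dvd_of_eq (by ring)).trans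
    (sub_dvd_pow_sub_pow (z' ^ p + t' ^ (p + 1)) (z ^ p + t ^ (p + 1)) (p + 1)))
  refine (dvd_add hz h3).trans (dvd_of_eq ?_)
  simp only [lineCoord]
  ring

variable {p : ℕ} [hp : Fact p.Prime] [CharP R p]

theorem lineEq_param (w : R) : lineEq p (w - w ^ (p ^ 2 + p)) (-w ^ (p ^ 2)) = 0 := by
  have h1 : (-1 : R) ^ (p ^ 2 + p) = 1 :=
    Even.neg_one_pow (by rw [sq]; exact Nat.even_mul_succ_self p)
  rw [lineEq, sub_pow_char_pow, neg_pow (w ^ p ^ 2), h1]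
  ring

theorem lineCoord_param (w : R) :
    lineCoord p (w - w ^ (p ^ 2 + p)) (-w ^ (p ^ 2)) = w := by
  have h1 : (-1 : R) ^ (p + 1) = 1 := by
    rw [pow_succ, neg_one_pow_char R p]
    ring
  rw [lineCoord, sub_pow_char, neg_pow (w ^ p ^ 2), h1]
  ring

theorem lineEq_dvd_lineCoord_pow_sub (z t : R) :
    lineEq p z t ∣ lineCoord p z t ^ p - (z ^ p + t ^ (p + 1)) := by
  have h1 : (-1 : R) ^ (p + 1) = 1 := by
    rw [pow_succ, neg_one_pow_char R p]
    ring
  have h2 : (z ^ p + t ^ (p + 1)) ^ p = lineEq p z t - t := by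
    rw [add_pow_char, lineEq]
    ring
  have h3 : lineCoord p z t ^ p = z ^ p + (lineEq p z t - t) ^ (p + 1) := by
    rw [lineCoord, add_pow_char, pow_right_comm, h2]
  have h4 := sub_dvd_pow_sub_pow (lineEq p z t - t) (-t) (p + 1)
  rw [neg_pow t, h1, one_mul, sub_neg_eq_add, sub_add_cancel] at h4
  rw [h3, add_sub_add_left_eq_sub]
  exact h4

theorem lineEq_dvd_sub_param_fst (z t : R) :
    lineEq p z t ∣ z - (lineCoord p z t - lineCoord p z t ^ (p ^ 2 + p)) := by
  have h := (lineEq_dvd_lineCoord_pow_sub (p := p) z t).trans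
    (sub_dvd_pow_sub_pow _ (z ^ p + t ^ (p + 1)) (p + 1))
  refine h.trans (dvd_of_eq ?_)
  rw [← pow_mul, show p * (p + 1) = p ^ 2 + p by ring,
    show (z ^ p + t ^ (p + 1)) ^ (p + 1) = lineCoord p z t - z by rw [lineCoord]; ring]
  ring

theorem lineEq_dvd_sub_param_snd (z t : R) :
    lineEq p z t ∣ t - -lineCoord p z t ^ (p ^ 2) := by
  have h := (lineEq_dvd_lineCoord_pow_sub (p := p) z t).trans
    (sub_dvd_pow_sub_pow _ (z ^ p + t ^ (p + 1)) p)
  refine (dvd_add h dvd_rfl).trans (dvd_of_eq ?_)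
  rw [← pow_mul, add_pow_char (z ^ p), lineEq]
  ring

variable {k : Type*} [Field k] [CharP k p] {m r : ℕ}

variable (k p m r) in
/-- The Asanuma rings are stably polynomial rings. -/
theorem nonempty_polynomial_algEquiv :
    Nonempty ((Asanuma k p m r)[X] ≃ₐ[k] MvPolynomial (Fin m ⊕ Fin 3) k) := by
  have := isDomain (k := k) (m := m) (r := r) hp.out.ne_zero
  set x : Fin m → MvPolynomial (Fin m ⊕ Fin 3) k := fun i => MvPolynomial.X (Sum.inl i)
  set W : MvPolynomial (Fin m ⊕ Fin 3) k := MvPolynomial.X (Sum.inr 0)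
  set Z : MvPolynomial (Fin m ⊕ Fin 3) k := MvPolynomial.X (Sum.inr 1)
  set T : MvPolynomial (Fin m ⊕ Fin 3) k := MvPolynomial.X (Sum.inr 2)
  set π := (∏ i, x i) ^ r
  have hπ : π ≠ 0 := pow_ne_zero _
    (Finset.prod_ne_zero_iff.mpr fun _ _ => MvPolynomial.X_ne_zero _)
  set z := W - W ^ (p ^ 2 + p) + π * Z
  set t := -W ^ (p ^ 2) + π * T
  have hz : π ∣ z - (W - W ^ (p ^ 2 + p)) := ⟨Z, by simp only [z]; ring⟩
  have ht : π ∣ t - -W ^ (p ^ 2) := ⟨T, by simp only [t]; ring⟩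
  obtain ⟨y, hy⟩ := dvd_lineEq_sub (p := p) hz ht
  obtain ⟨w, hw⟩ := dvd_lineCoord_sub (p := p) hz ht
  rw [lineEq_param, sub_zero] at hy
  rw [lineCoord_param] at hw
  let u : Option (Fin m ⊕ Fin 2) → MvPolynomial (Fin m ⊕ Fin 3) k :=
    fun o => o.elim y (Sum.elim x ![z, t])
  have hu : IsSolution p r u := hy.symm
  let α : (Asanuma k p m r)[X] →ₐ[k] MvPolynomial (Fin m ⊕ Fin 3) k :=
    eval₂AlgHom (lift u hu) (-w) fun _ => Commute.all _ _
  have hαC : ∀ o, α (C (gen o)) = u o := fun o => by simp [α]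
  have hαX : α X = -w := by simp [α]
  let g : Option (Fin m ⊕ Fin 2) → (Asanuma k p m r)[X] := fun o => C (gen o)
  have hg : IsSolution p r g := isSolution_gen.map C
  set zA := g (some (Sum.inr 0)) with hzA
  set tA := g (some (Sum.inr 1)) with htA
  set πA := (∏ i, g (some (Sum.inl i))) ^ r with hπA
  have hπA0 : πA ≠ 0 := by
    have h1 : πA = C (of k p m r (prodX k m ^ r)) := by
      rw [map_pow, of_prodX, map_pow, map_prod]
    rw [h1, Ne, C_eq_zero, map_eq_zero_iff _ of_injective]
    exact pow_ne_zero _ prodX_ne_zero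
  set WA := lineCoord p zA tA + πA * X with hWA
  have hdvd : πA ∣ lineEq p zA tA := ⟨_, hg.symm⟩
  obtain ⟨Z', hZ'⟩ : πA ∣ zA - (WA - WA ^ (p ^ 2 + p)) := by
    have h1 : πA ∣ lineCoord p zA tA - WA := ⟨-X, by rw [hWA]; ring⟩
    refine (dvd_add (hdvd.trans (lineEq_dvd_sub_param_fst zA tA)) (dvd_sub h1
      (h1.trans (sub_dvd_pow_sub_pow _ _ (p ^ 2 + p))))).trans (dvd_of_eq ?_)
    ring
  obtain ⟨T', hT'⟩ : πA ∣ tA - -WA ^ (p ^ 2) := by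
    have h1 : πA ∣ lineCoord p zA tA - WA := ⟨-X, by rw [hWA]; ring⟩
    refine (dvd_sub (hdvd.trans (lineEq_dvd_sub_param_snd zA tA))
      (h1.trans (sub_dvd_pow_sub_pow _ _ (p ^ 2)))).trans (dvd_of_eq ?_)
    ring
  let β : MvPolynomial (Fin m ⊕ Fin 3) k →ₐ[k] (Asanuma k p m r)[X] :=
    MvPolynomial.aeval (Sum.elim (fun i => g (some (Sum.inl i))) ![WA, Z', T'])
  have hβx : ∀ i, β (x i) = g (some (Sum.inl i)) := fun i => by simp [β, x]
  have hβW : β W = WA := by simp [β, W]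
  have hβZ : β Z = Z' := by simp [β, Z]
  have hβT : β T = T' := by simp [β, T]
  have hβπ : β π = πA := by simp only [π, map_pow, map_prod, hβx, hπA]
  have hβz : β z = zA := by
    simp only [z, map_add, map_sub, map_mul, map_pow, hβW, hβπ, hβZ, ← hZ']
    ring
  have hβt : β t = tA := by
    simp only [t, map_add, map_neg, map_mul, map_pow, hβW, hβπ, hβT, ← hT']
    ring
  have hαz : α zA = z := hαC _
  have hαt : α tA = t := hαC _
  have hαπ : α πA = π := by
    rw [hπA, map_pow, map_prod]
    simp only [g, hαC]
    rfl
  have hαW : α WA = W := by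
    rw [hWA, map_add, map_mul, map_lineCoord, hαz, hαt, hαπ, hαX]
    linear_combination hw
  refine ⟨AlgEquiv.ofAlgHom α β (MvPolynomial.algHom_ext fun l => ?_)
    (Polynomial.algHom_ext' (algHom_ext fun o => ?_) ?_)⟩
  · rw [AlgHom.comp_apply, AlgHom.id_apply]
    match l with
    | Sum.inl i => exact (congrArg α (hβx i)).trans (hαC _)
    | Sum.inr 0 => exact (congrArg α hβW).trans hαW
    | Sum.inr 1 =>
      refine (congrArg α hβZ).trans (mul_left_cancel₀ hπ ?_)
      have h1 := congrArg α hZ'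
      simp only [map_sub, map_mul, map_pow, hαW, hαz, hαπ] at h1
      rw [← h1]
      simp only [z, Z]
      ring
    | Sum.inr 2 =>
      refine (congrArg α hβT).trans (mul_left_cancel₀ hπ ?_)
      have h1 := congrArg α hT'
      simp only [map_sub, map_neg, map_mul, map_pow, hαW, hαt, hαπ] at h1
      rw [← h1]
      simp only [t, T]
      ring
  · change β (α (C (gen o))) = g o
    rw [hαC]
    match o with
    | none =>
      refine mul_left_cancel₀ hπA0 ?_
      have h1 := congrArg β hy
      rw [map_lineEq, map_mul, hβz, hβt, hβπ] at h1
      exact h1.symm.trans hg.symm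
    | some (Sum.inl i) => exact hβx i
    | some (Sum.inr 0) => exact hβz
    | some (Sum.inr 1) => exact hβt
  · change β (α X) = X
    rw [hαX]
    refine mul_left_cancel₀ hπA0 ?_
    have h1 := congrArg β hw
    rw [map_sub, map_lineCoord, map_mul, hβz, hβt, hβπ, hβW, hWA] at h1
    rw [map_neg]
    linear_combination h1

end StableIsomorphism

section Main

variable {k : Type*} [Field k] {p : ℕ} [hp : Fact p.Prime] [CharP k p]

variable (k p) in
theorem nonempty_polynomial_algEquiv_fin (m r : ℕ) :
    Nonempty ((Asanuma k p m r)[X] ≃ₐ[k] MvPolynomial (Fin (m + 3)) k) := by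
  obtain ⟨e⟩ := nonempty_polynomial_algEquiv p k m r
  exact ⟨e.trans (MvPolynomial.renameEquiv k finSumFinEquiv)⟩

variable (k p) in
theorem ringKrullDim_eq (m r : ℕ) : ringKrullDim (Asanuma k p m r) = (m + 2 : ℕ) := by
  obtain ⟨e⟩ := nonempty_polynomial_algEquiv_fin k p m r
  have : IsNoetherianRing (Asanuma k p m r) := Algebra.FiniteType.isNoetherianRing k _
  have h := ringKrullDim_eq_of_ringEquiv e.toRingEquiv
  rw [Polynomial.ringKrullDim_of_isNoetherianRing, MvPolynomial.ringKrullDim_of_isNoetherianRing,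
    ringKrullDim_eq_zero_of_field, zero_add, Nat.card_fin] at h
  have h1 : ((m + 3 : ℕ) : WithBot ℕ∞) = (m + 2 : ℕ) + 1 := by push_cast; ring
  exact ENat.WithBot.add_one_cancel.mp (h.trans h1)

theorem eq_of_algEquiv {m s s' : ℕ} (hm : m ≠ 0) (hs : s ≠ 0) (hs' : s' ≠ 0)
    (Φ : Asanuma k p m (p ^ 2 * s) ≃ₐ[k] Asanuma k p m (p ^ 2 * s')) : s = s' := by
  obtain ⟨e⟩ := nonempty_polynomial_algEquiv p k m (p ^ 2 * s)
  obtain ⟨e'⟩ := nonempty_polynomial_algEquiv p k m (p ^ 2 * s')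
  have h := Nat.dvd_antisymm (dvd_of_algEquiv hm hs' hs rfl rfl e' Φ)
    (dvd_of_algEquiv hm hs hs' rfl rfl e Φ.symm)
  exact Nat.eq_of_mul_eq_mul_left (pow_pos hp.out.pos 2) h

end Main

end Asanuma

end AsanumaRings

theorem statement18 (k : Type) [Field k] (hchar : ringChar k ≠ 0)
    (n : ℕ) (hn : 3 ≤ n) :
    ∃ C : ℕ → AffineDomain k,
      (∀ i, ringKrullDim (C i).carrier = n) ∧
      (∀ i j, i ≠ j → IsEmpty ((C i).carrier ≃ₐ[k] (C j).carrier)) ∧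
      (∀ i, Nonempty (Polynomial (C i).carrier ≃ₐ[k] MvPolynomial (Fin (n + 1)) k)) ∧
      (∀ i, IsEmpty ((C i).carrier ≃ₐ[k] MvPolynomial (Fin n) k)) := by
  have := ringChar.charP k
  have : Fact (ringChar k).Prime := ⟨(CharP.char_is_prime_or_zero k _).resolve_right hchar⟩
  obtain ⟨m, rfl⟩ : ∃ m, n = m + 2 := ⟨n - 2, by omega⟩
  set p := ringChar k
  have hdom : ∀ r, IsDomain (Asanuma k p m r) := fun _ => Asanuma.isDomain hchar
  have hm : m ≠ 0 := by omega
  have htriv : ∃ s₀, ∀ s > s₀, IsEmpty (Asanuma k p m (p ^ 2 * s) ≃ₐ[k]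
      MvPolynomial (Fin (m + 2)) k) := by
    by_cases h : ∃ s ≠ 0, Nonempty (Asanuma k p m (p ^ 2 * s) ≃ₐ[k]
      MvPolynomial (Fin (m + 2)) k)
    · obtain ⟨s₀, hs₀, ⟨e⟩⟩ := h
      exact ⟨s₀, fun s hs => ⟨fun e' =>
        hs.ne (Asanuma.eq_of_algEquiv hm hs₀ (by omega) (e.trans e'.symm))⟩⟩
    · push Not at h
      exact ⟨0, fun s hs => h s hs.ne'⟩
  obtain ⟨s₀, hs₀⟩ := htriv
  refine ⟨fun i => ⟨Asanuma k p m (p ^ 2 * (s₀ + i + 1))⟩,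
    fun i => Asanuma.ringKrullDim_eq k p m _, fun i j hij => ⟨fun e => hij ?_⟩,
    fun i => Asanuma.nonempty_polynomial_algEquiv_fin k p m _, fun i => hs₀ _ (by omega)⟩
  have := Asanuma.eq_of_algEquiv hm (by omega) (by omega) e
  omega
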